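/- Let G be a finite simple graph on n ≥ 1 vertices such that |E(G)| = ⌊(n/2) · Σ_{v ∈ V(G)} (c(v) − 1)/c(v)⌋, where c(v) is the order of the largest clique of G containing v, and let ω denote the clique number of G (the maximum of c(v) over all vertices). Then either c(v) = ω for every vertex v of G, or there exists a vertex v₀ with c(v₀) = ω − 1 such that c(v) = ω for every vertex v ≠ v₀. -/

import Mathlib

open Finset SimpleGraph

/-- `cliqueOrderAt G v` is the order of the largest clique of `G` containing `v`
(`1` if `v` is isolated, witnessed by the singleton clique `{v}`). -/
noncomputable def cliqueOrderAt {V : Type*} (G : SimpleGraph V) (v : V) : ℕ :=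
  sSup {r : ℕ | ∃ s : Finset V, G.IsNClique r s ∧ v ∈ s}

lemma SimpleGraph.IsClique.card_le_cliqueOrderAt {V : Type*} [Fintype V] {G : SimpleGraph V}
    {s : Finset V} (hs : G.IsClique s) {v : V} (hv : v ∈ s) : #s ≤ cliqueOrderAt G v := by
  refine le_csSup ⟨Fintype.card V, ?_⟩ ⟨s, ⟨hs, rfl⟩, hv⟩
  rintro r ⟨t, ht, -⟩
  exact ht.card_eq ▸ t.card_le_univ

lemma cliqueOrderAt_pos {V : Type*} [Fintype V] (G : SimpleGraph V) (v : V) :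
    0 < cliqueOrderAt G v := by
  have h : G.IsClique (({v} : Finset V) : Set V) := by simp
  exact h.card_le_cliqueOrderAt (mem_singleton_self v)

lemma cliqueOrderAt_le_cliqueNum {V : Type*} [Fintype V] (G : SimpleGraph V) (v : V) :
    cliqueOrderAt G v ≤ G.cliqueNum := by
  refine csSup_le ⟨1, {v}, by simp [isNClique_iff], by simp⟩ ?_
  rintro r ⟨t, ht, -⟩
  exact ht.card_eq ▸ ht.isClique.card_le_cliqueNum

lemma two_mul_add_tsub_le {d k c : ℕ} (hc : 0 < c) (hdk : d + 1 ≤ k) (hdc : d + 1 ≤ c) :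
    2 * (d : ℝ) + ((k - c : ℕ) : ℝ) ≤ k * (((c : ℝ) - 1) / c) + (k - 1) := by
  have hc' : (1 : ℝ) ≤ c := by exact_mod_cast hc
  have hdk' : (d : ℝ) + 1 ≤ k := by exact_mod_cast hdk
  have hdc' : (d : ℝ) + 1 ≤ c := by exact_mod_cast hdc
  rw [← mul_div_assoc, ← sub_le_iff_le_add, le_div_iff₀ (by linarith)]
  rcases le_total k c with h | h
  · have h' : (k : ℝ) ≤ c := by exact_mod_cast h
    rw [Nat.sub_eq_zero_of_le h]
    push_cast
    nlinarith
  · have h' : (c : ℝ) ≤ k := by exact_mod_cast h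
    rw [Nat.cast_sub h]
    nlinarith

section CliqueRemoval

variable {V : Type*} [DecidableEq V] (G : SimpleGraph V) [DecidableRel G.Adj]

lemma sum_adj_clique {K : Finset V} (hK : G.IsClique K) :
    ∑ u ∈ K, (#{v ∈ K | G.Adj u v} : ℝ) = #K * (#K - 1) := by
  rw [← nsmul_eq_mul, ← sum_const]
  refine sum_congr rfl fun u hu => ?_
  have : ({v ∈ K | G.Adj u v} : Finset V) = K.erase u := by
    ext v
    simp only [mem_filter, mem_erase]
    exact ⟨fun h => ⟨h.2.ne', h.1⟩, fun h => ⟨h.2, hK hu h.2 h.1.symm⟩⟩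
  rw [this, cast_card_erase_of_mem hu]

lemma sum_adj_union {K R : Finset V} (h : Disjoint K R) :
    ∑ u ∈ K ∪ R, (#{v ∈ K ∪ R | G.Adj u v} : ℝ) =
      ∑ u ∈ K, (#{v ∈ K | G.Adj u v} : ℝ) + 2 * ∑ u ∈ R, (#{v ∈ K | G.Adj u v} : ℝ) +
        ∑ u ∈ R, (#{v ∈ R | G.Adj u v} : ℝ) := by
  have hcomm : ∑ u ∈ K, (#{v ∈ R | G.Adj u v} : ℝ) = ∑ u ∈ R, (#{v ∈ K | G.Adj u v} : ℝ) := by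
    simp only [card_filter, Nat.cast_sum]
    rw [sum_comm]
    simp only [G.adj_comm]
  have hsplit (u : V) : (#{v ∈ K ∪ R | G.Adj u v} : ℝ) =
      #{v ∈ K | G.Adj u v} + #{v ∈ R | G.Adj u v} := by
    rw [filter_union, card_union_of_disjoint (disjoint_filter_filter h), Nat.cast_add]
  simp only [sum_union h, hsplit, sum_add_distrib, hcomm]
  ring

variable [Fintype V]

lemma card_filter_adj_lt_cliqueOrderAt {K : Finset V} (hK : G.IsClique K) (v : V) :
    #{u ∈ K | G.Adj v u} + 1 ≤ cliqueOrderAt G v := by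
  have hcl : G.IsClique (insert v {u ∈ K | G.Adj v u} : Finset V) := by
    rw [coe_insert, isClique_insert]
    exact ⟨hK.subset (by exact_mod_cast filter_subset _ _), fun u hu _ => by simp_all⟩
  have := hcl.card_le_cliqueOrderAt (mem_insert_self _ _)
  rwa [card_insert_of_notMem (by simp)] at this

/-- Removing a clique `K` that no vertex of `R` extends loses at least `#K - c(v)` for every
vertex `v` of `R` in the vertex-localized Turán bound. -/
lemma sum_adj_union_add_le {K R : Finset V} (h : Disjoint K R) (hK : G.IsClique K)
    (hmax : ∀ v ∈ R, #{u ∈ K | G.Adj v u} + 1 ≤ #K)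
    (hR : ∑ u ∈ R, (#{v ∈ R | G.Adj u v} : ℝ) ≤
      #R * ∑ v ∈ R, ((cliqueOrderAt G v : ℝ) - 1) / cliqueOrderAt G v) :
    ∑ u ∈ K ∪ R, (#{v ∈ K ∪ R | G.Adj u v} : ℝ) +
        ∑ v ∈ R, ((#K - cliqueOrderAt G v : ℕ) : ℝ) ≤
      #(K ∪ R) * ∑ v ∈ K ∪ R, ((cliqueOrderAt G v : ℝ) - 1) / cliqueOrderAt G v := by
  rw [sum_adj_union G h, sum_adj_clique G hK, sum_union h, card_union_of_disjoint h]
  have hrow := sum_le_sum fun v hv => two_mul_add_tsub_le (cliqueOrderAt_pos G v)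
    (hmax v hv) (card_filter_adj_lt_cliqueOrderAt G hK v)
  rw [sum_add_distrib, sum_add_distrib, ← mul_sum, ← mul_sum, sum_const, nsmul_eq_mul] at hrow
  have hKw : (#K : ℝ) - 1 ≤ ∑ v ∈ K, ((cliqueOrderAt G v : ℝ) - 1) / cliqueOrderAt G v := by
    rcases K.eq_empty_or_nonempty with rfl | hne
    · simp
    have hk : (0 : ℝ) < #K := by exact_mod_cast hne.card_pos
    calc (#K : ℝ) - 1 = ∑ _v ∈ K, ((#K : ℝ) - 1) / #K := by
          rw [sum_const, nsmul_eq_mul]; field_simp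
      _ ≤ _ := sum_le_sum fun v hv => by
          have hle : (#K : ℝ) ≤ cliqueOrderAt G v := by
            exact_mod_cast hK.card_le_cliqueOrderAt hv
          rw [div_le_div_iff₀ hk (hk.trans_le hle)]
          nlinarith
  have hmul := mul_le_mul_of_nonneg_left hKw (by positivity : (0 : ℝ) ≤ #K + #R)
  push_cast
  linarith

/-- The vertex-localized Turán bound for the subgraph induced on `S`. -/
lemma sum_adj_le_card_mul_sum_cliqueOrderAt (S : Finset V) :
    ∑ u ∈ S, (#{v ∈ S | G.Adj u v} : ℝ) ≤
      #S * ∑ v ∈ S, ((cliqueOrderAt G v : ℝ) - 1) / cliqueOrderAt G v := by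
  induction S using Finset.strongInduction with
  | H S ih =>
    rcases S.eq_empty_or_nonempty with rfl | ⟨x, hx⟩
    · simp
    obtain ⟨K, hKmem, hKmax⟩ := exists_max_image
      (S.powerset.filter fun K : Finset V => G.IsClique K) card ⟨∅, by simp⟩
    simp only [mem_filter, mem_powerset] at hKmem hKmax
    obtain ⟨hKS, hK⟩ := hKmem
    have hne : K.Nonempty := card_pos.1 <| Nat.lt_of_lt_of_le (by simp) <|
      hKmax {x} ⟨by simpa using hx, by simp⟩
    have hmax : ∀ v ∈ S \ K, #{u ∈ K | G.Adj v u} + 1 ≤ #K := by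
      intro v hv
      rw [← card_insert_of_notMem (s := {u ∈ K | G.Adj v u}) (a := v) (by simp)]
      refine hKmax _ ⟨insert_subset (mem_sdiff.1 hv).1 ((filter_subset _ _).trans hKS), ?_⟩
      rw [coe_insert, isClique_insert]
      exact ⟨hK.subset (by exact_mod_cast filter_subset _ _), fun u hu _ => by simp_all⟩
    have key := sum_adj_union_add_le G disjoint_sdiff hK hmax (ih _ (sdiff_ssubset hKS hne))
    rw [union_sdiff_of_subset hKS] at key
    exact (le_add_of_nonneg_right (sum_nonneg fun _ _ => Nat.cast_nonneg _)).trans key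

end CliqueRemoval

theorem extremal_weights_almost_constant {V : Type*} [Fintype V] [DecidableEq V]
    (G : SimpleGraph V) [DecidableRel G.Adj] (hn : 1 ≤ Fintype.card V)
    (heq : (G.edgeFinset.card : ℤ) =
      ⌊((Fintype.card V : ℝ) / 2) *
        ∑ v : V, ((cliqueOrderAt G v : ℝ) - 1) / (cliqueOrderAt G v)⌋) :
    (∀ v : V, cliqueOrderAt G v = G.cliqueNum) ∨
      (∃ v₀ : V, cliqueOrderAt G v₀ = G.cliqueNum - 1 ∧
        ∀ v : V, v ≠ v₀ → cliqueOrderAt G v = G.cliqueNum) := by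
  obtain ⟨K, hK⟩ := G.exists_isNClique_cliqueNum
  have hle := cliqueOrderAt_le_cliqueNum G
  have hKc : ∀ v ∈ K, G.cliqueNum - cliqueOrderAt G v = 0 := fun v hv =>
    Nat.sub_eq_zero_of_le (hK.card_eq ▸ hK.isClique.card_le_cliqueOrderAt hv)
  have key := sum_adj_union_add_le G (disjoint_compl_right (a := K)) hK.isClique
    (fun v _ => (card_filter_adj_lt_cliqueOrderAt G hK.isClique v).trans
      (hK.card_eq ▸ hle v)) (sum_adj_le_card_mul_sum_cliqueOrderAt G _)
  have hdeg : ∑ u : V, (#{v | G.Adj u v} : ℝ) = 2 * #G.edgeFinset := by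
    have := G.sum_degrees_eq_twice_card_edges
    simp only [← card_neighborFinset_eq_degree, neighborFinset_eq_filter] at this
    exact_mod_cast this
  rw [union_compl, hdeg, card_univ, hK.card_eq] at key
  have hlt := (Int.floor_eq_iff.1 heq.symm).2
  push_cast at hlt
  have hsum : ∑ v : V, (G.cliqueNum - cliqueOrderAt G v) ≤ 1 := by
    rw [← sum_add_sum_compl K, sum_eq_zero hKc, zero_add, ← Nat.lt_succ_iff]
    have : ∑ v ∈ Kᶜ, ((G.cliqueNum - cliqueOrderAt G v : ℕ) : ℝ) < 2 := by linarith
    exact_mod_cast this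
  by_cases hall : ∀ v, cliqueOrderAt G v = G.cliqueNum
  · exact Or.inl hall
  push Not at hall
  obtain ⟨v₀, hv₀⟩ := hall
  have hv₀le := hle v₀
  rw [← add_sum_erase _ _ (mem_univ v₀)] at hsum
  refine Or.inr ⟨v₀, by omega, fun v hv => ?_⟩
  have hsingle := single_le_sum (f := fun v => G.cliqueNum - cliqueOrderAt G v)
    (fun _ _ => Nat.zero_le _) (mem_erase.2 ⟨hv, mem_univ v⟩)
  have := hle v
  omega
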